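/- arXiv:1608.03913 — 2 statements merged into one kernel-verified Lean document; each statement's English description precedes it below -/
import Mathlib

section
/- Let d ≥ 1 and let f₀ : ℝ^d → ℝ be twice continuously differentiable on an open set U containing the closed segment [μ₀, μ] between two points μ₀, μ ∈ ℝ^d. Suppose there is λ₀ > 0 such that for every x on the segment [μ₀, μ] and every v ∈ ℝ^d, the Hessian quadratic form satisfies vᵀ Hf₀(x) v ≤ −λ₀‖v‖². Let f : ℝ^d → ℝ be differentiable at μ with ∇f(μ) = 0, and suppose ∇f₀(μ₀) = 0. Then ‖μ − μ₀‖ ≤ (1/λ₀)‖∇f₀(μ) − ∇f(μ)‖ ≤ (√d/λ₀) max_{1≤k≤d} sup_{x ∈ U} |∂_k f(x) − ∂_k f₀(x)| (where the norms are Euclidean ℓ₂ norms and ∂_k denotes the k-th partial derivative, assuming f is differentiable on U so the suprema are well defined). -/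
/-- Mean value inequality for the gradient along a segment, in the direction of the segment. -/
theorem fderiv_sub_fderiv_le_of_hessian_le
    {E : Type*} [NormedAddCommGroup E] [NormedSpace ℝ E]
    {U : Set E} (hU : IsOpen U) {a b : E} (hseg : segment ℝ a b ⊆ U) {g : E → ℝ}
    (hg : ContDiffOn ℝ 2 g U) {c : ℝ}
    (hc : ∀ x ∈ segment ℝ a b, fderiv ℝ (fderiv ℝ g) x (b - a) (b - a) ≤ c) :
    fderiv ℝ g b (b - a) - fderiv ℝ g a (b - a) ≤ c := by
  have hmem : ∀ t ∈ Set.Icc (0 : ℝ) 1, AffineMap.lineMap a b t ∈ segment ℝ a b := fun t ht => by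
    rw [segment_eq_image_lineMap]
    exact Set.mem_image_of_mem _ ht
  have hderiv : ∀ t ∈ Set.Icc (0 : ℝ) 1,
      HasDerivAt (fun t : ℝ => fderiv ℝ g (AffineMap.lineMap a b t) (b - a))
        (fderiv ℝ (fderiv ℝ g) (AffineMap.lineMap a b t) (b - a) (b - a)) t := fun t ht => by
    have hU' := hU.mem_nhds (hseg (hmem t ht))
    have hdiff : DifferentiableAt ℝ (fderiv ℝ g) (AffineMap.lineMap a b t) :=
      ((hg.contDiffAt hU').fderiv_right (m := 1) (by norm_num)).differentiableAt (by norm_num)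
    have hcomp := hdiff.hasFDerivAt.comp_hasDerivAt t
      (AffineMap.hasDerivAt_lineMap (a := a) (b := b) (x := t))
    simpa using hcomp.clm_apply (hasDerivAt_const t (b - a))
  obtain ⟨t, ht, heq⟩ := exists_hasDerivAt_eq_slope _ _ zero_lt_one
    (fun t ht => (hderiv t ht).continuousAt.continuousWithinAt)
    (fun t ht => hderiv t (Set.Ioo_subset_Icc_self ht))
  have hle := hc _ (hmem t (Set.Ioo_subset_Icc_self ht))
  rw [heq] at hle
  simpa using hle

/-- The Euclidean norm is at most `√d` times any bound on the absolute values of the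
coordinates. -/
theorem EuclideanSpace.norm_le_sqrt_card_mul {ι : Type*} [Fintype ι] (x : EuclideanSpace ℝ ι)
    {M : ℝ} (hM : 0 ≤ M) (hx : ∀ i, |x i| ≤ M) : ‖x‖ ≤ √(Fintype.card ι) * M := by
  rw [EuclideanSpace.norm_eq, ← Real.sqrt_sq hM, ← Real.sqrt_mul (Nat.cast_nonneg _)]
  refine Real.sqrt_le_sqrt ?_
  calc ∑ i, ‖x i‖ ^ 2 ≤ ∑ _i : ι, M ^ 2 :=
        Finset.sum_le_sum fun i _ => pow_le_pow_left₀ (norm_nonneg _) (hx i) 2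
    _ = Fintype.card ι * M ^ 2 := by simp

/-- The distance from a critical point is controlled by the gradient under strong concavity along
the connecting segment. -/
theorem norm_sub_le_norm_gradient_of_hessian_le
    {E : Type*} [NormedAddCommGroup E] [InnerProductSpace ℝ E] [CompleteSpace E]
    {U : Set E} (hU : IsOpen U) {a b : E} (hseg : segment ℝ a b ⊆ U) {g : E → ℝ}
    (hg : ContDiffOn ℝ 2 g U) {c : ℝ} (hc : 0 < c)
    (hHess : ∀ x ∈ segment ℝ a b, ∀ v : E, fderiv ℝ (fderiv ℝ g) x v v ≤ -c * ‖v‖ ^ 2)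
    (ha : gradient g a = 0) : ‖b - a‖ ≤ 1 / c * ‖gradient g b‖ := by
  have hmv := fderiv_sub_fderiv_le_of_hessian_le hU hseg hg fun x hx => hHess x hx (b - a)
  rw [← inner_gradient_left, ← inner_gradient_left, ha, inner_zero_left, sub_zero] at hmv
  have hcs := neg_le_of_abs_le (abs_real_inner_le_norm (gradient g b) (b - a))
  rw [one_div, ← div_eq_inv_mul, le_div_iff₀ hc]
  rcases (norm_nonneg (b - a)).eq_or_lt with h | h
  · simp [← h]
  · exact le_of_mul_le_mul_right (by linarith) h


/-- If `f₀` is C² on an open set `U` containing the segment `[μ₀, μ]` with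
Hessian quadratic form `≤ -λ₀‖v‖²` along the segment, `∇f₀(μ₀) = 0`, and `f` is
differentiable at `μ` with `∇f(μ) = 0`, then
`‖μ - μ₀‖ ≤ (1/λ₀)‖∇f₀(μ) - ∇f(μ)‖ ≤ (√d/λ₀) maxₖ sup_{x∈U} |∂ₖf(x) - ∂ₖf₀(x)|`. -/
theorem mode_error_bounded_by_gradient_supnorm
    (d : ℕ) (hd : 1 ≤ d)
    (U : Set (EuclideanSpace ℝ (Fin d))) (hU : IsOpen U)
    (μ₀ μ : EuclideanSpace ℝ (Fin d)) (hseg : segment ℝ μ₀ μ ⊆ U)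
    (f₀ f : EuclideanSpace ℝ (Fin d) → ℝ)
    (hf₀ : ContDiffOn ℝ 2 f₀ U)
    (lam₀ : ℝ) (hlam₀ : 0 < lam₀)
    (hHess : ∀ x ∈ segment ℝ μ₀ μ, ∀ v : EuclideanSpace ℝ (Fin d),
      fderiv ℝ (fderiv ℝ f₀) x v v ≤ -lam₀ * ‖v‖ ^ 2)
    (hfdiff : DifferentiableOn ℝ f U)
    (hfμ : DifferentiableAt ℝ f μ)
    (hgradf : gradient f μ = 0)
    (hgradf₀ : gradient f₀ μ₀ = 0)
    (hbdd : ∀ k : Fin d, BddAbove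
      ((fun x => |fderiv ℝ f x (EuclideanSpace.single k 1)
        - fderiv ℝ f₀ x (EuclideanSpace.single k 1)|) '' U)) :
    ‖μ - μ₀‖ ≤ (1 / lam₀) * ‖gradient f₀ μ - gradient f μ‖ ∧
    (1 / lam₀) * ‖gradient f₀ μ - gradient f μ‖ ≤
      (Real.sqrt d / lam₀) * ⨆ k : Fin d,
        sSup ((fun x => |fderiv ℝ f x (EuclideanSpace.single k 1)
          - fderiv ℝ f₀ x (EuclideanSpace.single k 1)|) '' U) := by
  rw [hgradf, sub_zero]
  refine ⟨norm_sub_le_norm_gradient_of_hessian_le hU hseg hf₀ hlam₀ hHess hgradf₀, ?_⟩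
  have hμU : μ ∈ U := hseg (right_mem_segment ℝ μ₀ μ)
  have hfd : fderiv ℝ f μ = 0 := by
    ext v
    rw [← inner_gradient_left, hgradf, inner_zero_left, zero_apply]
  have hcoord : ∀ k : Fin d, |gradient f₀ μ k| ≤ ⨆ k : Fin d,
      sSup ((fun x => |fderiv ℝ f x (EuclideanSpace.single k 1)
        - fderiv ℝ f₀ x (EuclideanSpace.single k 1)|) '' U) := fun k => by
    refine le_ciSup_of_le (Set.finite_range _).bddAbove k (le_csSup (hbdd k) ⟨μ, hμU, ?_⟩)
    simp [hfd, ← inner_gradient_left, EuclideanSpace.inner_single_right]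
  have hnorm := EuclideanSpace.norm_le_sqrt_card_mul _
    ((abs_nonneg _).trans (hcoord ⟨0, hd⟩)) hcoord
  rw [Fintype.card_fin] at hnorm
  rw [div_mul_eq_mul_div, div_mul_eq_mul_div, one_mul]
  gcongr
end

section
/- Let Z be a real n×p matrix and V a real p×p symmetric positive definite matrix. Then 0 ≤ tr(I_n − (Z V Zᵀ + I_n)⁻¹) ≤ p. -/
open Matrix

open scoped MatrixOrder in
/-- The trace of a product of two positive semidefinite real matrices is nonnegative. -/
theorem Matrix.PosSemidef.trace_mul_nonneg {m : Type*} [Fintype m]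
    {A B : Matrix m m ℝ} (hA : A.PosSemidef) (hB : B.PosSemidef) :
    0 ≤ (A * B).trace := by
  classical
  obtain ⟨C, rfl⟩ := CStarAlgebra.nonneg_iff_eq_star_mul_self.mp hA.nonneg
  rw [star_eq_conjTranspose, Matrix.mul_assoc, Matrix.trace_mul_comm]
  exact (hB.mul_mul_conjTranspose_same C).trace_nonneg

/-- For a real `n×p` matrix `Z` and a positive definite `p×p` matrix `V`,
`0 ≤ tr(I_n − (ZVZᵀ + I_n)⁻¹) ≤ p`. -/
theorem trace_smoother_bound
    (n p : ℕ) (Z : Matrix (Fin n) (Fin p) ℝ)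
    (V : Matrix (Fin p) (Fin p) ℝ) (hV : V.PosDef) :
    0 ≤ Matrix.trace ((1 : Matrix (Fin n) (Fin n) ℝ) - (Z * V * Zᵀ + 1)⁻¹) ∧
    Matrix.trace ((1 : Matrix (Fin n) (Fin n) ℝ) - (Z * V * Zᵀ + 1)⁻¹) ≤ (p : ℝ) := by
  have hB : (V⁻¹ + Zᵀ * Z).PosDef :=
    hV.inv.add_posSemidef (posSemidef_conjTranspose_mul_self Z)
  have woodbury : 1 - (Z * V * Zᵀ + 1)⁻¹ = Z * (V⁻¹ + Zᵀ * Z)⁻¹ * Zᵀ := by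
    rw [add_comm, add_mul_mul_inv_eq_sub 1 Z V Zᵀ isUnit_one hV.isUnit (by simpa using hB.isUnit)]
    simp
  rw [woodbury]
  refine ⟨(hB.inv.posSemidef.mul_mul_conjTranspose_same Z).trace_nonneg, ?_⟩
  have hinv : (V⁻¹ + Zᵀ * Z)⁻¹ * (V⁻¹ + Zᵀ * Z) = 1 :=
    nonsing_inv_mul _ ((isUnit_iff_isUnit_det _).mp hB.isUnit)
  have htrace := congrArg trace hinv
  rw [Matrix.mul_add, trace_add, trace_one, Fintype.card_fin] at htrace
  have hnonneg := hB.inv.posSemidef.trace_mul_nonneg hV.inv.posSemidef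
  rw [Matrix.mul_assoc, Matrix.trace_mul_comm, Matrix.mul_assoc]
  linarith
end
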